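/- Let n = 2m be even, let W be a ℂ-vector space, and work in the exterior algebra Λ(W ⊕ ℂⁿ) with generators η_i := ι(0,e_i). Let ω be an n×n skew-symmetric matrix whose entries ω_{ij} are even elements of the subalgebra Λ(W), and let J_1,…,J_n be odd elements of Λ(W) (i.e., sums of elements of odd exterior degree in W). Then the Berezin integral satisfies ∫𝒟η exp((1/2) Σ_{i,j} ω_{ij} η_i η_j + Σ_i J_i η_i) = Σ_{I even} ε(I,I') (−1)^{|I'|/2} Pf(ω_I) J^{I'}, where the sum runs over subsets I of {1,…,n} of even cardinality, I' is the complement of I in {1,…,n}, ω_I is the submatrix of ω indexed by I, Pf is the combinatorial Pfaffian, J^{I'} is the product of the J_j with j ∈ I' in increasing order, and ε(I,I') ∈ {±1} is defined by η^I η^{I'} = ε(I,I') η_1⋯η_n. -/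

import Mathlib

open scoped BigOperators
open Matrix

/-- The combinatorial Pfaffian of an `n × n` matrix (intended for even `n = 2k`) with
entries in a (possibly noncommutative) `ℂ`-algebra; the combinatorial formula
`Pf(A) = (1/(2^k k!)) Σ_{σ ∈ S_{2k}} sgn(σ) Π_{l=1}^{k} A_{σ(2l-1), σ(2l)}`
is well defined for matrices whose entries pairwise commute. -/
noncomputable def pfaffian {A : Type*} [Ring A] [Algebra ℂ A] {n : ℕ}
    (M : Matrix (Fin n) (Fin n) A) : A :=
  ((2 ^ (n / 2) * (Nat.factorial (n / 2)) : ℂ))⁻¹ •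
    ∑ σ : Equiv.Perm (Fin n),
      ((Equiv.Perm.sign σ : ℤ) : ℂ) •
        ((List.finRange (n / 2)).map fun l =>
          M (σ ⟨2 * l.val, by have := l.isLt; omega⟩)
            (σ ⟨2 * l.val + 1, by have := l.isLt; omega⟩)).prod

variable (W : Type*) [AddCommGroup W] [Module ℂ W]

/-- The even part of the exterior algebra `Λ(W)`: the sum of the exterior powers of
even degree, the `i`-th graded piece being `(range ι)^i`. -/
noncomputable def evenPart : Submodule ℂ (ExteriorAlgebra ℂ W) :=
  ⨆ i : ℕ, (LinearMap.range (ExteriorAlgebra.ι ℂ (M := W))) ^ (2 * i)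

/-- The odd part of the exterior algebra `Λ(W)`: the sum of the exterior powers of
odd degree. -/
noncomputable def oddPart : Submodule ℂ (ExteriorAlgebra ℂ W) :=
  ⨆ i : ℕ, (LinearMap.range (ExteriorAlgebra.ι ℂ (M := W))) ^ (2 * i + 1)

variable (n : ℕ)

/-- The inclusion `Λ(W) → Λ(W ⊕ ℂⁿ)` induced by `W → W ⊕ ℂⁿ`. -/
noncomputable def inclW : ExteriorAlgebra ℂ W →ₐ[ℂ] ExteriorAlgebra ℂ (W × (Fin n → ℂ)) :=
  ExteriorAlgebra.map (LinearMap.inl ℂ W (Fin n → ℂ))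

/-- The generators `η i = ι(0, e i)` of `Λ(W ⊕ ℂⁿ)` coming from the `ℂⁿ` factor. -/
noncomputable def etaGen (i : Fin n) : ExteriorAlgebra ℂ (W × (Fin n → ℂ)) :=
  ExteriorAlgebra.ι ℂ ((0 : W), Pi.single i (1 : ℂ))

/-- For `I = {i₁ < … < i_k} ⊆ {1,…,n}`, the monomial `η^I = η_{i₁} ⋯ η_{i_k}`. -/
noncomputable def etaMonomial (I : Finset (Fin n)) :
    ExteriorAlgebra ℂ (W × (Fin n → ℂ)) :=
  ((I.sort (· ≤ ·)).map (etaGen W n)).prod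

/-- The submatrix `ω_I` of `ω` with rows and columns indexed by `I` (in increasing order). -/
def Matrix.subByFinset {A : Type*} {n : ℕ} (ω : Matrix (Fin n) (Fin n) A)
    (I : Finset (Fin n)) : Matrix (Fin I.card) (Fin I.card) A :=
  fun a b => ω (I.orderIsoOfFin rfl a) (I.orderIsoOfFin rfl b)

section aux
variable {W n}

theorem eta_swap (i j : Fin n) : etaGen W n i * etaGen W n j = -(etaGen W n j * etaGen W n i) :=
  eq_neg_of_add_eq_zero_left (ExteriorAlgebra.ι_add_mul_swap _ _)

theorem incl_ι_swap (w : W) (v : W × (Fin n → ℂ)) :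
    inclW W n (ExteriorAlgebra.ι ℂ w) * ExteriorAlgebra.ι ℂ v =
      -(ExteriorAlgebra.ι ℂ v * inclW W n (ExteriorAlgebra.ι ℂ w)) := by
  rw [inclW, ExteriorAlgebra.map_apply_ι]
  exact eq_neg_of_add_eq_zero_left (ExteriorAlgebra.ι_add_mul_swap _ _)

theorem incl_pow_comm (y : ExteriorAlgebra ℂ (W × (Fin n → ℂ)))
    (hy : ∀ w : W, inclW W n (ExteriorAlgebra.ι ℂ w) * y =
      -(y * inclW W n (ExteriorAlgebra.ι ℂ w))) (k : ℕ) (x : ExteriorAlgebra ℂ W)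
    (hx : x ∈ (LinearMap.range (ExteriorAlgebra.ι ℂ (M := W))) ^ k) :
    inclW W n x * y = (-1 : ℂ) ^ k • (y * inclW W n x) := by
  induction hx using Submodule.pow_induction_on_left' with
  | algebraMap r => simp [Algebra.commutes]
  | add x y i hx hy h1 h2 => simp [add_mul, mul_add, h1, h2]
  | mem_mul m hm i x hx ih =>
    obtain ⟨w, rfl⟩ := hm
    rw [map_mul, mul_assoc, ih, mul_smul_comm, ← mul_assoc, hy, pow_succ]
    simp [mul_assoc]

theorem even_comm (y : ExteriorAlgebra ℂ (W × (Fin n → ℂ)))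
    (hy : ∀ w : W, inclW W n (ExteriorAlgebra.ι ℂ w) * y =
      -(y * inclW W n (ExteriorAlgebra.ι ℂ w))) (x : ExteriorAlgebra ℂ W)
    (hx : x ∈ evenPart W) : Commute (inclW W n x) y := by
  unfold evenPart at hx
  refine Submodule.iSup_induction _ (motive := fun x => Commute (inclW W n x) y) hx ?_ ?_ ?_
  · intro i x hx
    have := incl_pow_comm y hy _ x hx
    simpa [Commute, SemiconjBy] using this
  · simp
  · intro a b ha hb
    rw [map_add]; exact ha.add_left hb

theorem odd_comm (y : ExteriorAlgebra ℂ (W × (Fin n → ℂ)))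
    (hy : ∀ w : W, inclW W n (ExteriorAlgebra.ι ℂ w) * y =
      -(y * inclW W n (ExteriorAlgebra.ι ℂ w))) (x : ExteriorAlgebra ℂ W)
    (hx : x ∈ oddPart W) : inclW W n x * y = -(y * inclW W n x) := by
  unfold oddPart at hx
  refine Submodule.iSup_induction _
    (motive := fun x => inclW W n x * y = -(y * inclW W n x)) hx ?_ ?_ ?_
  · intro i x hx
    have := incl_pow_comm y hy _ x hx
    simpa [pow_succ] using this
  · simp
  · intro a b ha hb
    rw [map_add, add_mul, mul_add, ha, hb]; abel

theorem hy_eta (i : Fin n) (w : W) : inclW W n (ExteriorAlgebra.ι ℂ w) * etaGen W n i =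
      -(etaGen W n i * inclW W n (ExteriorAlgebra.ι ℂ w)) := incl_ι_swap _ _

theorem hy_odd (x : ExteriorAlgebra ℂ W) (hx : x ∈ oddPart W) (w : W) :
    inclW W n (ExteriorAlgebra.ι ℂ w) * inclW W n x =
      -(inclW W n x * inclW W n (ExteriorAlgebra.ι ℂ w)) := by
  have h := odd_comm (n := n) (inclW W n (ExteriorAlgebra.ι ℂ w)) (fun w' => by
    have := incl_ι_swap (n := n) w' (LinearMap.inl ℂ W (Fin n → ℂ) w)
    rw [← ExteriorAlgebra.map_apply_ι] at this
    exact this) x hx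
  rw [h, neg_neg]

theorem eta_prod_dup (l : List (Fin n)) (h : ¬ l.Nodup) : (l.map (etaGen W n)).prod = 0 := by
  have := ExteriorAlgebra.ιMulti_eq_zero_of_not_inj (R := ℂ)
    (v := fun i : Fin l.length => ((0 : W), (Pi.single (l.get i) (1 : ℂ) : Fin n → ℂ))) (by
      intro hinj
      apply h
      rw [List.nodup_iff_injective_get]
      intro a b hab
      apply hinj
      simp only [hab])
  rw [ExteriorAlgebra.ιMulti_apply] at this
  rw [← this]
  congr 1
  conv_lhs => rw [← List.ofFn_get l]
  rw [List.map_ofFn]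
  rfl

theorem eta_prod_perm (l l' : List (Fin n)) (h : l.Perm l') :
    ∃ s : ℂ, (l.map (etaGen W n)).prod = s • (l'.map (etaGen W n)).prod := by
  induction h with
  | nil => exact ⟨1, by simp⟩
  | cons x h ih =>
    obtain ⟨s, hs⟩ := ih
    exact ⟨s, by simp [hs]⟩
  | swap x y l =>
    refine ⟨-1, ?_⟩
    simp only [List.map_cons, List.prod_cons, ← mul_assoc]
    rw [eta_swap y x]; simp
  | trans _ _ ih1 ih2 =>
    obtain ⟨s, hs⟩ := ih1
    obtain ⟨t, ht⟩ := ih2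
    exact ⟨s * t, by rw [hs, ht, smul_smul]⟩

/-- contraction -/
noncomputable def Dc (i : Fin n) :
    ExteriorAlgebra ℂ (W × (Fin n → ℂ)) →ₗ[ℂ] ExteriorAlgebra ℂ (W × (Fin n → ℂ)) :=
  (CliffordAlgebra.contractRight (Q := (0 : QuadraticForm ℂ (W × (Fin n → ℂ))))).flip
    ((LinearMap.proj i).comp (LinearMap.snd ℂ W (Fin n → ℂ)))

theorem Dc_mul_ι (i : Fin n) (x : ExteriorAlgebra ℂ (W × (Fin n → ℂ))) (v : W × (Fin n → ℂ)) :
    Dc i (x * ExteriorAlgebra.ι ℂ v) = v.2 i • x - Dc i x * ExteriorAlgebra.ι ℂ v :=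
  CliffordAlgebra.contractRight_mul_ι _ _ _

theorem Dc_incl_mul (i : Fin n) (x : ExteriorAlgebra ℂ W) (a : ExteriorAlgebra ℂ (W × (Fin n → ℂ)))
    (ha : Dc i a = 0) : Dc i (a * inclW W n x) = 0 := by
  induction x using ExteriorAlgebra.induction generalizing a with
  | algebraMap r => simp [← Algebra.commutes r, ← Algebra.smul_def, ha]
  | ι w =>
    rw [inclW, ExteriorAlgebra.map_apply_ι, Dc_mul_ι, ha]; simp
  | mul x y hx hy => rw [map_mul (inclW W n), ← mul_assoc]; exact hy _ (hx _ ha)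
  | add x y hx hy => rw [map_add, mul_add, map_add, hx _ ha, hy _ ha, add_zero]

theorem Dc_incl (i : Fin n) (x : ExteriorAlgebra ℂ W) : Dc i (inclW W n x) = 0 := by
  have := Dc_incl_mul i x 1 (CliffordAlgebra.contractRight_one _ _)
  simpa using this

theorem Dc_notMem (i : Fin n) (x : ExteriorAlgebra ℂ W) (l : List (Fin n)) (h : i ∉ l) :
    Dc i (inclW W n x * (l.reverse.map (etaGen W n)).prod) = 0 := by
  induction l with
  | nil => simp [Dc_incl]
  | cons j l ih =>
    simp only [List.mem_cons, not_or] at h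
    rw [List.reverse_cons, List.map_append, List.prod_append, ← mul_assoc]
    simp only [List.map_cons, List.map_nil, List.prod_cons, List.prod_nil, mul_one]
    rw [etaGen, Dc_mul_ι, ih h.2]
    simp [h.1]

/-- iterated contraction -/
noncomputable def Dl : List (Fin n) →
    ExteriorAlgebra ℂ (W × (Fin n → ℂ)) →ₗ[ℂ] ExteriorAlgebra ℂ (W × (Fin n → ℂ))
  | [] => LinearMap.id
  | a :: L => (Dl L).comp (Dc a)

theorem Dl_apply (L l : List (Fin n)) (h : l.Sublist L) (hL : L.Nodup) (x : ExteriorAlgebra ℂ W) :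
    Dl L (inclW W n x * (l.reverse.map (etaGen W n)).prod) =
      if l = L then inclW W n x else 0 := by
  induction h with
  | slnil => simp [Dl]
  | cons a h ih =>
    rename_i l₁ l₂
    rw [Dl, LinearMap.comp_apply, Dc_notMem, map_zero, if_neg]
    · rintro rfl
      exact (List.nodup_cons.1 hL).1 (h.subset (by simp))
    · exact fun h' => (List.nodup_cons.1 hL).1 (h.subset h')
  | cons_cons a h ih =>
    rename_i l₁ l₂
    have hn := (List.nodup_cons.1 hL)
    rw [Dl, LinearMap.comp_apply]
    rw [List.reverse_cons, List.map_append, List.prod_append, ← mul_assoc]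
    simp only [List.map_cons, List.map_nil, List.prod_cons, List.prod_nil, mul_one]
    rw [etaGen, Dc_mul_ι, Dc_notMem _ _ _ (fun h' => hn.1 (h.subset h'))]
    simpa using ih hn.2

variable (W n) in
/-- Berezin functional -/
noncomputable def Bz : ExteriorAlgebra ℂ (W × (Fin n → ℂ)) →ₗ[ℂ] ExteriorAlgebra ℂ W :=
  (ExteriorAlgebra.map (LinearMap.fst ℂ W (Fin n → ℂ))).toLinearMap.comp
    (Dl (List.finRange n).reverse)

theorem Bz_apply (x : ExteriorAlgebra ℂ W) (I : Finset (Fin n)) :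
    Bz W n (inclW W n x * etaMonomial W n I) = if I = Finset.univ then x else 0 := by
  have h1 : (I.sort (· ≤ ·)).Sublist (List.finRange n) := by
    refine List.sublist_of_subperm_of_sortedLE ?_ (Finset.sortedLT_sort I).sortedLE ?_
    · exact (Finset.sort_nodup _ _).subperm (fun a _ => List.mem_finRange a)
    · rw [← Fin.sort_univ]; exact (Finset.sortedLT_sort _).sortedLE
  have h2 := Dl_apply (W := W) _ _ (List.reverse_sublist.2 h1)
    (List.nodup_reverse.2 (List.nodup_finRange n)) x
  rw [List.reverse_reverse] at h2
  rw [Bz, LinearMap.comp_apply, etaMonomial, h2]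
  have h3 : (I.sort (· ≤ ·)).reverse = (List.finRange n).reverse ↔ I = Finset.univ := by
    rw [List.reverse_inj]
    constructor
    · intro h
      rw [← Finset.sort_toFinset I (· ≤ ·), h]; ext; simp
    · rintro rfl; exact Fin.sort_univ n
  simp only [h3]
  split_ifs
  · change ExteriorAlgebra.map _ (ExteriorAlgebra.map _ x) = x
    rw [← AlgHom.comp_apply, ExteriorAlgebra.map_comp_map]
    simp
  · simp

theorem sum_words {M : Type*} [AddCommMonoid M] (G : ∀ m : ℕ, (Fin m → Fin n) → M)
    (hG : ∀ m f, ¬ Function.Injective f → G m f = 0) (m : ℕ) :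
    ∑ f : Fin m → Fin n, G m f =
      ∑ I ∈ Finset.powersetCard m (Finset.univ : Finset (Fin n)),
        ∑ σ : Equiv.Perm (Fin I.card), G I.card (fun i => (I.orderIsoOfFin rfl (σ i) : Fin n)) := by
  classical
  have h1 : ∑ f : Fin m → Fin n, G m f =
      ∑ f ∈ Finset.univ.filter (fun f : Fin m → Fin n => Function.Injective f), G m f := by
    symm
    apply Finset.sum_subset (Finset.subset_univ _)
    intro f _ hf
    exact hG m f (by simpa using hf)
  rw [h1, ← Finset.sum_fiberwise_of_maps_to (g := fun f : Fin m → Fin n => Finset.univ.image f)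
    (t := Finset.powersetCard m (Finset.univ : Finset (Fin n)))]
  · apply Finset.sum_congr rfl
    intro I hI
    obtain ⟨-, rfl⟩ := Finset.mem_powersetCard.1 hI
    symm
    refine Finset.sum_bij (fun σ _ i => (I.orderIsoOfFin rfl (σ i) : Fin n)) ?_ ?_ ?_ ?_
    · intro σ _
      simp only [Finset.mem_filter, Finset.mem_univ, true_and]
      constructor
      · intro a b hab
        simpa using hab
      · ext x
        simp only [Finset.mem_image, Finset.mem_univ, true_and]
        constructor
        · rintro ⟨a, rfl⟩; exact Subtype.prop _
        · intro hx
          exact ⟨σ.symm ((I.orderIsoOfFin rfl).symm ⟨x, hx⟩), by simp⟩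
    · intro σ _ τ _ h
      ext i
      have := congrFun h i
      exact congrArg Fin.val (by simpa using this)
    · intro f hf
      simp only [Finset.mem_filter, Finset.mem_univ, true_and] at hf
      have hm : ∀ i, f i ∈ I := fun i => by rw [← hf.2]; simp
      refine ⟨Equiv.ofBijective (fun i => (I.orderIsoOfFin rfl).symm ⟨f i, hm i⟩) ?_,
        Finset.mem_univ _, ?_⟩
      · apply Finite.injective_iff_bijective.1
        intro a b hab
        apply hf.1
        simpa using hab
      · ext i
        simp
    · intros; rfl
  · intro f hf
    simp only [Finset.mem_filter, Finset.mem_univ, true_and] at hf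
    simp [Finset.mem_powersetCard, Finset.card_image_of_injective _ hf]

theorem ofFn_sort (I : Finset (Fin n)) :
    List.ofFn (fun i => (I.orderIsoOfFin rfl i : Fin n)) = I.sort (· ≤ ·) := by
  apply List.ext_get
  · simp
  · intro i h1 h2
    simp [Finset.orderIsoOfFin]
    rfl

theorem eta_ofFn {k : ℕ} (f : Fin k → Fin n) : ((List.ofFn f).map (etaGen W n)).prod =
    ExteriorAlgebra.ιMulti ℂ k (fun i => ((0 : W), (Pi.single (f i) (1 : ℂ) : Fin n → ℂ))) := by
  rw [ExteriorAlgebra.ιMulti_apply, List.map_ofFn]; rfl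

theorem eta_ofFn_perm {k : ℕ} (f : Fin k → Fin n) (σ : Equiv.Perm (Fin k)) :
    ((List.ofFn (fun i => f (σ i))).map (etaGen W n)).prod =
      ((Equiv.Perm.sign σ : ℤ) : ℂ) • ((List.ofFn f).map (etaGen W n)).prod := by
  rw [eta_ofFn, eta_ofFn]
  have := (ExteriorAlgebra.ιMulti ℂ k).map_perm
    (fun i => ((0 : W), (Pi.single (f i) (1 : ℂ) : Fin n → ℂ))) σ
  rw [Function.comp_def] at this
  rw [this, Units.smul_def, Int.cast_smul_eq_zsmul]

/-- word for the quadratic part -/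
noncomputable def Gw (ω : Matrix (Fin n) (Fin n) (ExteriorAlgebra ℂ W)) (m : ℕ)
    (f : Fin m → Fin n) : ExteriorAlgebra ℂ (W × (Fin n → ℂ)) :=
  inclW W n ((List.finRange (m / 2)).map fun l =>
          ω (f ⟨2 * l.val, by have := l.isLt; omega⟩)
            (f ⟨2 * l.val + 1, by have := l.isLt; omega⟩)).prod *
    ((List.ofFn f).map (etaGen W n)).prod

theorem Gw_eq (ω : Matrix (Fin n) (Fin n) (ExteriorAlgebra ℂ W)) (a m : ℕ) (h : m / 2 = a)
    (f : Fin m → Fin n) : Gw ω m f = inclW W n ((List.finRange a).map fun l =>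
          ω (f ⟨2 * l.val, by have := l.isLt; omega⟩)
            (f ⟨2 * l.val + 1, by have := l.isLt; omega⟩)).prod *
    ((List.ofFn f).map (etaGen W n)).prod := by
  subst h; rfl

theorem sum_cons {M : Type*} [AddCommMonoid M] {k : ℕ} (F : (Fin (k + 1) → Fin n) → M) :
    ∑ f, F f = ∑ i, ∑ g : Fin k → Fin n, F (Fin.cons i g) := by
  rw [← Fintype.sum_prod_type']
  exact (Fintype.sum_equiv (Fin.consEquiv (fun _ => Fin n)) _ _ (fun _ => rfl)).symm

theorem Q_pow (ω : Matrix (Fin n) (Fin n) (ExteriorAlgebra ℂ W))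
    (hωeven : ∀ i j, ω i j ∈ evenPart W) (a : ℕ) :
    (∑ i : Fin n, ∑ j : Fin n, inclW W n (ω i j) * etaGen W n i * etaGen W n j) ^ a =
      ∑ f : Fin (2 * a) → Fin n, Gw ω (2 * a) f := by
  induction a with
  | zero => simp [Gw]
  | succ a ih =>
    rw [pow_succ', ih]
    change _ = ∑ f : Fin (2 * a + 1 + 1) → Fin n, Gw ω (2 * a + 1 + 1) f
    rw [sum_cons, Finset.sum_mul]
    refine Finset.sum_congr rfl fun i _ => ?_
    rw [sum_cons, Finset.sum_mul]
    refine Finset.sum_congr rfl fun j _ => ?_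
    rw [Finset.mul_sum]
    refine Finset.sum_congr rfl fun g _ => ?_
    rw [Gw_eq ω a (2 * a) (by omega), Gw_eq ω (a + 1) (2 * a + 1 + 1) (by omega)]
    rw [List.finRange_succ, List.map_cons, List.prod_cons, List.map_map, map_mul]
    rw [List.ofFn_cons, List.ofFn_cons]
    simp only [List.map_cons, List.prod_cons]
    change _ = inclW W n (ω i j) * inclW W n ((List.finRange a).map fun l =>
          ω (g ⟨2 * l.val, by have := l.isLt; omega⟩)
            (g ⟨2 * l.val + 1, by have := l.isLt; omega⟩)).prod * _
    set P := inclW W n ((List.finRange a).map fun l =>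
          ω (g ⟨2 * l.val, by have := l.isLt; omega⟩)
            (g ⟨2 * l.val + 1, by have := l.isLt; omega⟩)).prod with hP
    have hc : ∀ k, Commute P (etaGen W n k) := by
      intro k
      rw [hP, map_list_prod]
      apply Commute.list_prod_left
      intro x hx
      simp only [List.map_map, List.mem_map] at hx
      obtain ⟨l, -, rfl⟩ := hx
      exact even_comm _ (hy_eta k) _ (hωeven _ _)
    have h2 : Commute P (etaGen W n i * etaGen W n j) := (hc i).mul_right (hc j)
    simp only [← mul_assoc] at h2 ⊢
    congr 1
    simp only [mul_assoc]
    congr 1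
    simpa [mul_assoc] using h2.eq.symm

theorem Q_pow' (ω : Matrix (Fin n) (Fin n) (ExteriorAlgebra ℂ W))
    (hωeven : ∀ i j, ω i j ∈ evenPart W) (a : ℕ) :
    (Nat.factorial a : ℂ)⁻¹ • ((((1 : ℂ) / 2) •
      ∑ i : Fin n, ∑ j : Fin n, inclW W n (ω i j) * etaGen W n i * etaGen W n j) ^ a) =
      ∑ I ∈ Finset.powersetCard (2 * a) (Finset.univ : Finset (Fin n)),
        inclW W n (pfaffian (ω.subByFinset I)) * etaMonomial W n I := by
  rw [smul_pow, Q_pow ω hωeven, sum_words (Gw ω)]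
  · rw [smul_smul, Finset.smul_sum]
    refine Finset.sum_congr rfl fun I hI => ?_
    have hI2 : I.card / 2 = a := by
      have := (Finset.mem_powersetCard.1 hI).2; omega
    subst hI2
    rw [pfaffian, map_smul, map_sum, smul_mul_assoc, Finset.sum_mul]
    congr 1
    · rw [mul_inv, mul_comm]; simp
    · refine Finset.sum_congr rfl fun σ _ => ?_
      rw [Gw, eta_ofFn_perm (fun i => (I.orderIsoOfFin rfl i : Fin n)), ofFn_sort, map_smul,
        smul_mul_assoc, mul_smul_comm]
      rfl
  · intro m f hf
    rw [Gw, eta_prod_dup, mul_zero]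
    rwa [List.nodup_ofFn]

theorem J_comm (J : Fin n → ExteriorAlgebra ℂ W) (hJodd : ∀ i, J i ∈ oddPart W) (i j : Fin n) :
    Commute (inclW W n (J i) * etaGen W n i) (inclW W n (J j) * etaGen W n j) := by
  have h1 := odd_comm (n := n) (etaGen W n i) (hy_eta i) (J j) (hJodd j)
  have h2 := odd_comm (n := n) (etaGen W n j) (hy_eta j) (J i) (hJodd i)
  have h3 := odd_comm (n := n) (inclW W n (J i)) (hy_odd _ (hJodd i)) (J j) (hJodd j)
  have h4 := eta_swap (W := W) i j
  have h1' : etaGen W n i * inclW W n (J j) = -(inclW W n (J j) * etaGen W n i) := by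
    rw [h1, neg_neg]
  have h2' : etaGen W n j * inclW W n (J i) = -(inclW W n (J i) * etaGen W n j) := by
    rw [h2, neg_neg]
  rw [Commute, SemiconjBy]
  calc inclW W n (J i) * etaGen W n i * (inclW W n (J j) * etaGen W n j)
      = inclW W n (J i) * (etaGen W n i * inclW W n (J j)) * etaGen W n j := by
        simp only [mul_assoc]
    _ = -((inclW W n (J i) * inclW W n (J j)) * (etaGen W n i * etaGen W n j)) := by
        rw [h1']; simp only [mul_neg, neg_mul, mul_assoc]
    _ = -((inclW W n (J j) * inclW W n (J i)) * (etaGen W n j * etaGen W n i)) := by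
        rw [h4, h3]; simp
    _ = inclW W n (J j) * (etaGen W n j * inclW W n (J i)) * etaGen W n i := by
        rw [h2']; simp only [mul_neg, neg_mul, mul_assoc]
    _ = _ := by simp only [mul_assoc]

/-- sign -/
def sgnJ : ℕ → ℂ
  | 0 => 1
  | b + 1 => (-1) ^ b * sgnJ b

theorem sgnJ_even (b : ℕ) : sgnJ (2 * b) = (-1) ^ b := by
  induction b with
  | zero => simp [sgnJ]
  | succ b ih =>
    change (-1) ^ (2 * b + 1) * ((-1) ^ (2 * b) * sgnJ (2 * b)) = _
    rw [ih, pow_succ, pow_succ, pow_mul]; simp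

theorem eta_Jprod (J : Fin n → ExteriorAlgebra ℂ W) (hJodd : ∀ i, J i ∈ oddPart W) (i : Fin n)
    (l : List (Fin n)) : etaGen W n i * inclW W n (l.map J).prod =
      (-1 : ℂ) ^ l.length • (inclW W n (l.map J).prod * etaGen W n i) := by
  induction l with
  | nil => simp
  | cons j l ih =>
    have h1 := odd_comm (n := n) (etaGen W n i) (hy_eta i) (J j) (hJodd j)
    have h1' : etaGen W n i * inclW W n (J j) = -(inclW W n (J j) * etaGen W n i) := by
      rw [h1, neg_neg]
    rw [List.map_cons, List.prod_cons, map_mul, ← mul_assoc, h1', neg_mul, mul_assoc, ih,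
      List.length_cons, pow_succ]
    simp [mul_assoc]

theorem J_word (J : Fin n → ExteriorAlgebra ℂ W) (hJodd : ∀ i, J i ∈ oddPart W)
    (l : List (Fin n)) : (l.map (fun i => inclW W n (J i) * etaGen W n i)).prod =
      sgnJ l.length • (inclW W n (l.map J).prod * (l.map (etaGen W n)).prod) := by
  induction l with
  | nil => simp [sgnJ]
  | cons j l ih =>
    rw [List.map_cons, List.prod_cons, ih, List.length_cons, sgnJ]
    simp only [List.map_cons, List.prod_cons, map_mul]
    rw [mul_smul_comm, mul_assoc, ← mul_assoc (etaGen W n j), eta_Jprod J hJodd]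
    simp only [smul_mul_assoc, mul_smul_comm, smul_smul, mul_assoc]
    rw [mul_comm]

theorem S_pow (J : Fin n → ExteriorAlgebra ℂ W) (b : ℕ) :
    (∑ i : Fin n, inclW W n (J i) * etaGen W n i) ^ b =
      ∑ f : Fin b → Fin n,
        ((List.ofFn f).map (fun i => inclW W n (J i) * etaGen W n i)).prod := by
  induction b with
  | zero => simp
  | succ b ih =>
    rw [pow_succ', ih, sum_cons, Finset.sum_mul]
    refine Finset.sum_congr rfl fun i _ => ?_
    rw [Finset.mul_sum]
    refine Finset.sum_congr rfl fun g _ => ?_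
    rw [List.ofFn_cons, List.map_cons, List.prod_cons]

theorem S_pow' (J : Fin n → ExteriorAlgebra ℂ W) (hJodd : ∀ i, J i ∈ oddPart W) (b : ℕ) :
    (Nat.factorial b : ℂ)⁻¹ • ((∑ i : Fin n, inclW W n (J i) * etaGen W n i) ^ b) =
      ∑ K ∈ Finset.powersetCard b (Finset.univ : Finset (Fin n)),
        sgnJ K.card • (inclW W n ((K.sort (· ≤ ·)).map J).prod * etaMonomial W n K) := by
  rw [S_pow, sum_words (fun b f =>
    ((List.ofFn f).map (fun i => inclW W n (J i) * etaGen W n i)).prod)]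
  · rw [Finset.smul_sum]
    refine Finset.sum_congr rfl fun K hK => ?_
    have hK2 := (Finset.mem_powersetCard.1 hK).2
    have : ∀ σ : Equiv.Perm (Fin K.card),
        ((List.ofFn (fun i => (K.orderIsoOfFin rfl (σ i) : Fin n))).map
          (fun i => inclW W n (J i) * etaGen W n i)).prod =
        sgnJ K.card • (inclW W n ((K.sort (· ≤ ·)).map J).prod * etaMonomial W n K) := by
      intro σ
      have hp := Equiv.Perm.ofFn_comp_perm σ (fun i => (K.orderIsoOfFin rfl i : Fin n))
      rw [Function.comp_def] at hp
      rw [List.Perm.prod_eq' (hp.map _), ofFn_sort, J_word J hJodd, Finset.length_sort,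
        etaMonomial]
      rw [List.pairwise_map]
      exact List.pairwise_of_forall (fun i j => J_comm J hJodd i j)
    rw [Finset.sum_congr rfl (fun σ _ => this σ), Finset.sum_const, Finset.card_univ,
      Fintype.card_perm, Fintype.card_fin, hK2, ← Nat.cast_smul_eq_nsmul ℂ, smul_smul,
      inv_mul_cancel₀ (by exact_mod_cast Nat.factorial_ne_zero b), one_smul]
  · intro m f hf
    rw [J_word J hJodd, eta_prod_dup, mul_zero, smul_zero]
    rwa [List.nodup_ofFn]

theorem Q_comm_S (ω : Matrix (Fin n) (Fin n) (ExteriorAlgebra ℂ W))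
    (hωeven : ∀ i j, ω i j ∈ evenPart W)
    (J : Fin n → ExteriorAlgebra ℂ W) (hJodd : ∀ i, J i ∈ oddPart W) :
    Commute (((1 : ℂ) / 2) •
      ∑ i : Fin n, ∑ j : Fin n, inclW W n (ω i j) * etaGen W n i * etaGen W n j)
      (∑ i : Fin n, inclW W n (J i) * etaGen W n i) := by
  apply Commute.smul_left
  apply Commute.sum_left
  intro i _
  apply Commute.sum_left
  intro j _
  apply Commute.sum_right
  intro k _
  have he : ∀ i, Commute (etaGen W n i) (inclW W n (J k) * etaGen W n k) := by
    intro i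
    have h1 := odd_comm (n := n) (etaGen W n i) (hy_eta i) (J k) (hJodd k)
    rw [Commute, SemiconjBy, mul_assoc, eta_swap k i, mul_neg, ← mul_assoc, ← mul_assoc, h1,
      neg_mul, neg_neg]
  have hw : Commute (inclW W n (ω i j)) (inclW W n (J k) * etaGen W n k) :=
    (even_comm _ (hy_odd _ (hJodd k)) _ (hωeven _ _)).mul_right
      (even_comm _ (hy_eta k) _ (hωeven _ _))
  exact (hw.mul_left (he i)).mul_left (he j)

theorem exp_term (ω : Matrix (Fin n) (Fin n) (ExteriorAlgebra ℂ W))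
    (hωeven : ∀ i j, ω i j ∈ evenPart W)
    (J : Fin n → ExteriorAlgebra ℂ W) (hJodd : ∀ i, J i ∈ oddPart W) (k : ℕ) :
    ((Nat.factorial k : ℂ))⁻¹ •
          ((((1 : ℂ) / 2) •
              ∑ i : Fin n, ∑ j : Fin n,
                inclW W n (ω i j) * etaGen W n i * etaGen W n j) +
            ∑ i : Fin n, inclW W n (J i) * etaGen W n i) ^ k =
    ∑ p ∈ Finset.HasAntidiagonal.antidiagonal k,
      (∑ I ∈ Finset.powersetCard (2 * p.1) (Finset.univ : Finset (Fin n)),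
        inclW W n (pfaffian (ω.subByFinset I)) * etaMonomial W n I) *
      (∑ K ∈ Finset.powersetCard p.2 (Finset.univ : Finset (Fin n)),
        sgnJ K.card • (inclW W n ((K.sort (· ≤ ·)).map J).prod * etaMonomial W n K)) := by
  rw [(Q_comm_S ω hωeven J hJodd).add_pow', Finset.smul_sum]
  refine Finset.sum_congr rfl fun p hp => ?_
  rw [← Q_pow' ω hωeven, ← S_pow' J hJodd, smul_mul_smul_comm, ← Nat.cast_smul_eq_nsmul ℂ,
    smul_smul]
  congr 1
  have hp := Finset.HasAntidiagonal.mem_antidiagonal.1 hp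
  subst hp
  rw [Nat.cast_add_choose]
  have h1 : ((p.1 + p.2).factorial : ℂ) ≠ 0 := by exact_mod_cast Nat.factorial_ne_zero _
  have h2 : ((p.1).factorial : ℂ) ≠ 0 := by exact_mod_cast Nat.factorial_ne_zero _
  have h3 : ((p.2).factorial : ℂ) ≠ 0 := by exact_mod_cast Nat.factorial_ne_zero _
  field_simp

theorem etas_Jprod (J : Fin n → ExteriorAlgebra ℂ W) (hJodd : ∀ i, J i ∈ oddPart W)
    (l' l : List (Fin n)) : (l'.map (etaGen W n)).prod * inclW W n (l.map J).prod =
      ((-1 : ℂ) ^ l.length) ^ l'.length •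
        (inclW W n (l.map J).prod * (l'.map (etaGen W n)).prod) := by
  induction l' with
  | nil => simp
  | cons j l' ih =>
    rw [List.map_cons, List.prod_cons, mul_assoc, ih, mul_smul_comm, ← mul_assoc,
      eta_Jprod J hJodd, List.length_cons, pow_succ, smul_mul_assoc, smul_smul, mul_assoc]

theorem Bz_term {m : ℕ} (hn : n = 2 * m) (ω : Matrix (Fin n) (Fin n) (ExteriorAlgebra ℂ W))
    (J : Fin n → ExteriorAlgebra ℂ W) (hJodd : ∀ i, J i ∈ oddPart W)
    (ε : Finset (Fin n) → ℂ)
    (hε : ∀ I : Finset (Fin n),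
      etaMonomial W n I * etaMonomial W n Iᶜ = ε I • etaMonomial W n Finset.univ)
    (I K : Finset (Fin n)) (hI : Even I.card) :
    Bz W n (inclW W n (pfaffian (ω.subByFinset I)) * etaMonomial W n I *
            sgnJ K.card • (inclW W n ((K.sort (· ≤ ·)).map J).prod * etaMonomial W n K)) =
    if K = Iᶜ then (ε I * (-1 : ℂ) ^ (Iᶜ.card / 2)) •
            (pfaffian (ω.subByFinset I) * ((Iᶜ.sort (· ≤ ·)).map J).prod) else 0 := by
  have h1 : inclW W n (pfaffian (ω.subByFinset I)) * etaMonomial W n I *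
            sgnJ K.card • (inclW W n ((K.sort (· ≤ ·)).map J).prod * etaMonomial W n K) =
      sgnJ K.card • (inclW W n (pfaffian (ω.subByFinset I) * ((K.sort (· ≤ ·)).map J).prod) *
        (etaMonomial W n I * etaMonomial W n K)) := by
    rw [mul_smul_comm, mul_assoc, ← mul_assoc (etaMonomial W n I)]
    nth_rw 1 [etaMonomial]
    rw [etas_Jprod J hJodd, Finset.length_sort (s := I), ← pow_mul, mul_comm, pow_mul,
      hI.neg_one_pow, one_pow, one_smul, map_mul]
    simp only [mul_assoc]
    rfl
  rw [h1, map_smul]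
  split_ifs with hK
  · subst hK
    rw [hε, mul_smul_comm, map_smul, Bz_apply, if_pos rfl, smul_smul, mul_comm]
    congr 2
    have h2 := Finset.card_add_card_compl I
    rw [Fintype.card_fin] at h2
    obtain ⟨r, hr⟩ := hI
    obtain ⟨q, hq⟩ : ∃ q, Iᶜ.card = 2 * q := ⟨m - r, by omega⟩
    rw [hq, sgnJ_even]; simp
  · have h2 : etaMonomial W n I * etaMonomial W n K =
        ((I.sort (· ≤ ·) ++ K.sort (· ≤ ·)).map (etaGen W n)).prod := by
      rw [List.map_append, List.prod_append]; rfl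
    rw [h2]
    by_cases hd : (I.sort (· ≤ ·) ++ K.sort (· ≤ ·)).Nodup
    · have hdis : Disjoint I K := by
        rw [Finset.disjoint_left]
        intro x hx hx'
        exact (List.disjoint_of_nodup_append hd) ((Finset.mem_sort _).2 hx)
          ((Finset.mem_sort _).2 hx')
      have hperm : (I.sort (· ≤ ·) ++ K.sort (· ≤ ·)).Perm ((I ∪ K).sort (· ≤ ·)) := by
        rw [List.perm_ext_iff_of_nodup hd (Finset.sort_nodup _ _)]
        intro x; simp
      obtain ⟨s, hs⟩ := eta_prod_perm (W := W) _ _ hperm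
      rw [hs, mul_smul_comm, map_smul]
      change _ • _ • Bz W n (_ * etaMonomial W n (I ∪ K)) = 0
      rw [Bz_apply, if_neg, smul_zero, smul_zero]
      intro hu
      apply hK
      ext x
      rw [Finset.mem_compl]
      constructor
      · intro hx hx'; exact Finset.disjoint_left.1 hdis hx' hx
      · intro hx
        have : x ∈ I ∪ K := by rw [hu]; simp
        exact (Finset.mem_union.1 this).resolve_left hx
    · rw [eta_prod_dup _ hd, mul_zero, map_zero, smul_zero]

end aux

/-- **Berezin integral of a Gaussian with sources.** For `n = 2m`, a skew-symmetric
`n × n` matrix `ω` with even entries in `Λ(W)` and odd elements `J₁,…,Jₙ` of `Λ(W)`,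
the Berezin integral (i.e. the top coefficient `c_{{1,…,n}}` in the unique expansion
`x = Σ_I c_I η^I` with `c_I ∈ Λ(W)`) of
`exp((1/2) Σ_{i,j} ω_{ij} η_i η_j + Σ_i J_i η_i)` equals
`Σ_{I even} ε(I,I') (−1)^{|I'|/2} Pf(ω_I) J^{I'}`, where `ε(I,I')` is defined by
`η^I η^{I'} = ε(I,I') η_1 ⋯ η_n`. -/
theorem berezin_gaussian_with_source (m : ℕ) (hn : n = 2 * m)
    (ω : Matrix (Fin n) (Fin n) (ExteriorAlgebra ℂ W))
    (hωeven : ∀ i j, ω i j ∈ evenPart W) (hskew : ωᵀ = -ω)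
    (J : Fin n → ExteriorAlgebra ℂ W) (hJodd : ∀ i, J i ∈ oddPart W)
    (ε : Finset (Fin n) → ℂ)
    (hε : ∀ I : Finset (Fin n),
      etaMonomial W n I * etaMonomial W n Iᶜ = ε I • etaMonomial W n Finset.univ)
    (c : Finset (Fin n) → ExteriorAlgebra ℂ W)
    (hc : ∑ k ∈ Finset.range (n + 1),
        ((Nat.factorial k : ℂ))⁻¹ •
          ((((1 : ℂ) / 2) •
              ∑ i : Fin n, ∑ j : Fin n,
                inclW W n (ω i j) * etaGen W n i * etaGen W n j) +
            ∑ i : Fin n, inclW W n (J i) * etaGen W n i) ^ k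
      = ∑ I : Finset (Fin n), inclW W n (c I) * etaMonomial W n I) :
    c Finset.univ
      = ∑ I ∈ Finset.univ.filter (fun I : Finset (Fin n) => Even I.card),
          (ε I * (-1 : ℂ) ^ (Iᶜ.card / 2)) •
            (pfaffian (ω.subByFinset I) * ((Iᶜ.sort (· ≤ ·)).map J).prod) := by
  have hB := congrArg (Bz W n) hc
  rw [map_sum (Bz W n) _ (Finset.univ : Finset (Finset (Fin n)))] at hB
  simp only [Bz_apply, Finset.sum_ite_eq', Finset.mem_univ, if_true] at hB
  rw [← hB, map_sum]
  simp only [exp_term ω hωeven J hJodd]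
  simp only [map_sum, Finset.sum_mul_sum]
  have key : ∀ k, ∀ p ∈ Finset.HasAntidiagonal.antidiagonal k,
      (∑ I ∈ Finset.powersetCard (2 * p.1) (Finset.univ : Finset (Fin n)),
        ∑ K ∈ Finset.powersetCard p.2 (Finset.univ : Finset (Fin n)),
          Bz W n (inclW W n (pfaffian (ω.subByFinset I)) * etaMonomial W n I *
            sgnJ K.card • (inclW W n ((K.sort (· ≤ ·)).map J).prod * etaMonomial W n K))) =
      ∑ I ∈ Finset.univ.filter (fun I : Finset (Fin n) => Even I.card),
        if p = (I.card / 2, Iᶜ.card) then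
          (ε I * (-1 : ℂ) ^ (Iᶜ.card / 2)) •
            (pfaffian (ω.subByFinset I) * ((Iᶜ.sort (· ≤ ·)).map J).prod) else 0 := by
    rintro k ⟨a, b⟩ -
    symm
    have hsub : Finset.powersetCard (2 * a) (Finset.univ : Finset (Fin n)) ⊆
        Finset.univ.filter (fun I : Finset (Fin n) => Even I.card) := by
      intro I hI
      have := (Finset.mem_powersetCard.1 hI).2
      simp [this]
    rw [← Finset.sum_subset hsub]
    · refine Finset.sum_congr rfl fun I hI => ?_
      have hIc := (Finset.mem_powersetCard.1 hI).2
      have hIe : Even I.card := by rw [hIc]; simp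
      rw [Finset.sum_congr rfl (fun K _ => Bz_term hn ω J hJodd ε hε I K hIe)]
      rw [Finset.sum_ite_eq']
      have : ((a, b) = (I.card / 2, Iᶜ.card)) ↔
          Iᶜ ∈ Finset.powersetCard b (Finset.univ : Finset (Fin n)) := by
        rw [Finset.mem_powersetCard, Prod.mk.injEq]
        constructor
        · rintro ⟨-, h⟩; exact ⟨Finset.subset_univ _, h.symm⟩
        · rintro ⟨-, h⟩; exact ⟨by omega, h.symm⟩
      simp only [this]
    · intro I hI hI'
      rw [if_neg]
      intro h
      rw [Prod.mk.injEq] at h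
      simp only [Finset.mem_filter, Finset.mem_univ, true_and] at hI
      apply hI'
      rw [Finset.mem_powersetCard]
      refine ⟨Finset.subset_univ _, ?_⟩
      have := Nat.two_mul_div_two_of_even hI
      omega
  rw [Finset.sum_congr rfl (fun k _ => Finset.sum_congr rfl (key k)), Finset.sum_sigma',
    Finset.sum_comm]
  refine Finset.sum_congr rfl fun I hI => ?_
  simp only [Finset.mem_filter, Finset.mem_univ, true_and] at hI
  rw [Finset.sum_eq_single ⟨I.card / 2 + Iᶜ.card, (I.card / 2, Iᶜ.card)⟩]
  · simp
  · rintro ⟨k, p⟩ hp hne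
    rw [if_neg]
    rintro rfl
    apply hne
    simp only [Finset.mem_sigma, Finset.HasAntidiagonal.mem_antidiagonal] at hp
    obtain ⟨-, h⟩ := hp
    subst h
    rfl
  · intro h
    exfalso
    apply h
    simp only [Finset.mem_sigma, Finset.HasAntidiagonal.mem_antidiagonal, Finset.mem_range, and_true]
    have h1 := Finset.card_add_card_compl I
    rw [Fintype.card_fin] at h1
    omega
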